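/- Let n < ω and let α be any ordinal. If α ∈ B_n(α), then ψ_n(α+1) = (ψ_n(α))^Γ, the least strongly critical ordinal strictly greater than ψ_n(α); and if α ∉ B_n(α), then ψ_n(α+1) = ψ_n(α). In particular, ψ_n(α+1) ∈ {ψ_n(α), (ψ_n(α))^Γ}. -/

import Mathlib

open Ordinal Set

/-- The Veblen hierarchy: `phi 0` is the strictly increasing enumeration of the
additively principal ordinals (nonzero ordinals closed under addition), and for `α > 0`,
`phi α` is the strictly increasing enumeration of the common fixed points of the
functions `phi δ` for `δ < α`. -/
noncomputable def phi : Ordinal → Ordinal → Ordinal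
  | α => Ordinal.enumOrd {β | (α = 0 → β ≠ 0 ∧ ∀ γ < β, ∀ δ < β, γ + δ < β) ∧
      ∀ δ, δ < α → phi δ β = β}
termination_by α => α
decreasing_by assumption

/-- `Cr 0` is the class of additively principal ordinals (nonzero ordinals `β` such that
`γ + δ < β` for all `γ, δ < β`); for `α > 0`, `Cr α = {β | ∀ δ < α, phi δ β = β}`.
`phi α` is (definitionally) the strictly increasing enumeration of `Cr α`. -/
def Cr (α : Ordinal) : Set Ordinal :=
  {β | (α = 0 → β ≠ 0 ∧ ∀ γ < β, ∀ δ < β, γ + δ < β) ∧ ∀ δ, δ < α → phi δ β = β}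

/-- An ordinal is strongly critical if it is nonzero and closed under `(δ, γ) ↦ phi δ γ`. -/
def StronglyCritical (α : Ordinal) : Prop :=
  α ≠ 0 ∧ ∀ δ < α, ∀ γ < α, phi δ γ < α

/-- `Gamma β` is the `β`-th strongly critical ordinal. -/
noncomputable def Gamma : Ordinal → Ordinal :=
  Ordinal.enumOrd {α | StronglyCritical α}

/-- An ordinal which is (the initial ordinal of) an uncountable regular cardinal. -/
def IsUncountableRegular (o : Ordinal) : Prop :=
  ∃ κ : Cardinal, Cardinal.aleph0 < κ ∧ κ.IsRegular ∧ o = κ.ord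

/-- The base sets `B_n^0(α)` (they do not depend on `α`):
`B_0^0(α) = {0} ∪ {Γ_β : β ≤ θ} ∪ {Ω_m : m ≤ ω}` and
`B_{n+1}^0(α) = {β : β < Ω_n} ∪ {Ω_m : m ≤ ω}`. -/
def Bbase (θ : Ordinal) (Ω : ℕ → Ordinal) (Ωω : Ordinal) : ℕ → Set Ordinal
  | 0 => {0} ∪ {x | ∃ β ≤ θ, x = Gamma β} ∪ {x | (∃ m : ℕ, x = Ω m) ∨ x = Ωω}
  | n + 1 => {β | β < Ω n} ∪ {x | (∃ m : ℕ, x = Ω m) ∨ x = Ωω}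

/-- One closure step, producing `B_n^{k+1}(α)` from `S = B_n^k(α)`, where the function `f`
plays the role of `ψ`:
`S ∪ {δ + δ' : δ, δ' ∈ S} ∪ {phi δ δ' : δ, δ' ∈ S} ∪ {f m δ : m < ω, δ ∈ S, δ < α}`. -/
def Bstep (f : ℕ → Ordinal → Ordinal) (α : Ordinal) (S : Set Ordinal) : Set Ordinal :=
  S ∪ {x | ∃ δ ∈ S, ∃ δ' ∈ S, x = δ + δ'}
    ∪ {x | ∃ δ ∈ S, ∃ δ' ∈ S, x = phi δ δ'}
    ∪ {x | ∃ m : ℕ, ∃ δ ∈ S, δ < α ∧ x = f m δ}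

/-- The sets `B_n^k(α)`, where the function `f` plays the role of `ψ`. -/
def Biter (θ : Ordinal) (Ω : ℕ → Ordinal) (Ωω : Ordinal)
    (f : ℕ → Ordinal → Ordinal) (α : Ordinal) (n : ℕ) : ℕ → Set Ordinal
  | 0 => Bbase θ Ω Ωω n
  | k + 1 => Bstep f α (Biter θ Ω Ωω f α n k)

/-- `psi θ Ω Ωω n α` is the least ordinal not in `B_n(α) = ⋃ k, B_n^k(α)`.  (The values of
`ψ` are only ever used at arguments `δ < α`, so the guard `if δ < α` does not change the
sets `B_n^k(α)`; it only serves to make the recursion on `α` well-founded.) -/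
noncomputable def psi (θ : Ordinal) (Ω : ℕ → Ordinal) (Ωω : Ordinal) : ℕ → Ordinal → Ordinal
  | n, α => sInf {β | β ∉ ⋃ k,
      Biter θ Ω Ωω (fun m δ => if _ : δ < α then psi θ Ω Ωω m δ else 0) α n k}
termination_by n α => α
decreasing_by assumption

/-- The set `B_n(α) = ⋃ k, B_n^k(α)`. -/
noncomputable def Bset (θ : Ordinal) (Ω : ℕ → Ordinal) (Ωω : Ordinal)
    (n : ℕ) (α : Ordinal) : Set Ordinal :=
  ⋃ k, Biter θ Ω Ωω (fun m δ => if _ : δ < α then psi θ Ω Ωω m δ else 0) α n k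

/-- `δ^Γ`: the least strongly critical ordinal strictly greater than `δ`. -/
noncomputable def nextGamma (δ : Ordinal) : Ordinal :=
  sInf {x | StronglyCritical x ∧ δ < x}

universe u

theorem addPrincipal_iff_mem_range_opow (b : Ordinal) :
    (b ≠ 0 ∧ ∀ γ < b, ∀ δ < b, γ + δ < b) ↔ b ∈ range (ω ^ · : Ordinal → Ordinal) := by
  have h := @isPrincipal_add_iff_zero_or_omega0_opow b
  constructor
  · rintro ⟨h0, hb⟩
    exact (h.1 fun γ δ hγ hδ => hb γ hγ δ hδ).resolve_left h0
  · intro hb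
    refine ⟨?_, fun γ hγ δ hδ => h.2 (.inr hb) hγ hδ⟩
    rintro rfl
    obtain ⟨x, hx⟩ := hb
    exact (opow_pos x omega0_pos).ne' hx

theorem phi_eq_veblen (a : Ordinal.{u}) : phi.{u, u} a = veblen a := by
  induction a using WellFoundedLT.induction with
  | ind a ih =>
    rw [phi, ← enumOrd_range (veblen_right_strictMono a)]
    congr 1
    ext b
    by_cases ha : a = 0
    · subst ha
      simpa [veblen_zero] using addPrincipal_iff_mem_range_opow b
    · rw [mem_range_veblen ha]
      simp only [ha, false_imp_iff, true_and, mem_ofPred_eq]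
      exact forall₂_congr fun δ hδ => by rw [ih δ hδ]

theorem left_le_phi (a b : Ordinal.{u}) : a ≤ phi a b := by
  rw [phi_eq_veblen]; exact left_le_veblen a b

theorem right_le_phi (a b : Ordinal.{u}) : b ≤ phi a b := by
  rw [phi_eq_veblen]; exact right_le_veblen a b

theorem StronglyCritical.add_lt {o a b : Ordinal} (ho : StronglyCritical o) (ha : a < o)
    (hb : b < o) : a + b < o := by
  have hv : ∀ c < o, veblen c c < o := fun c hc => by
    rw [← phi_eq_veblen]; exact ho.2 c hc c hc
  have h0 : (0 : Ordinal) < o := pos_iff_ne_zero.2 ho.1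
  set c := max a b with hc
  have hco : c < o := max_lt ha hb
  have hc1 : c + 1 < o := (Order.add_one_le_of_lt (lt_veblen c)).trans_lt (hv c hco)
  have hop : ω ^ (c + 1) < o := by
    rw [← veblen_zero_apply, ← phi_eq_veblen]
    exact ho.2 0 h0 _ hc1
  have hlt : c < ω ^ (c + 1) :=
    (Order.lt_add_one_iff.2 le_rfl).trans_le (right_le_opow _ one_lt_omega0)
  exact (isPrincipal_add_omega0_opow (c + 1) ((le_max_left a b).trans_lt hlt)
    ((le_max_right a b).trans_lt hlt)).trans hop

theorem exists_lt_of_not_stronglyCritical {o : Ordinal} (h0 : o ≠ 0)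
    (ho : ¬ StronglyCritical o) :
    ∃ a < o, ∃ b < o, o = a + b ∨ o = phi a b := by
  by_cases hp : IsPrincipal (· + ·) o
  · obtain ⟨x, rfl⟩ := (isPrincipal_add_iff_zero_or_omega0_opow.1 hp).resolve_left h0
    dsimp only at h0 ho ⊢
    have hx : x ≤ ω ^ x := right_le_opow _ one_lt_omega0
    rcases ((invVeblen₁_le x).trans hx).lt_or_eq with h | h
    · refine ⟨_, h, invVeblen₂ x, invVeblen₂_lt x, .inr ?_⟩
      rw [phi_eq_veblen, veblen_invVeblen₁_invVeblen₂]
    · have hxx : ω ^ x = x := le_antisymm (h ▸ invVeblen₁_le x) hx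
      rw [hxx] at h
      refine absurd ⟨h0, fun δ hδ γ hγ => ?_⟩ ho
      rw [hxx] at hδ hγ ⊢
      rw [phi_eq_veblen]
      calc veblen δ γ < veblen δ x := veblen_right_strictMono δ hγ
        _ = x := veblen_eq_of_lt_invVeblen₁ (h.symm ▸ hδ)
  · rw [isPrincipal_add_iff_add_lt_ne_self] at hp
    push Not at hp
    obtain ⟨a, ha, b, hb, h⟩ := hp
    exact ⟨a, ha, b, hb, .inl h.symm⟩

section Closure

variable {θ : Ordinal.{u}} {Ω : ℕ → Ordinal.{u}} {Ωω : Ordinal.{u}} {n : ℕ} {α β : Ordinal.{u}}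

theorem Biter_mono (f : ℕ → Ordinal → Ordinal) : Monotone (Biter θ Ω Ωω f α n) :=
  monotone_nat_of_le_succ fun _ _ hx => .inl (.inl (.inl hx))

theorem Bbase_subset_Bset : Bbase θ Ω Ωω n ⊆ Bset θ Ω Ωω n α :=
  fun _ hx => mem_iUnion.2 ⟨0, hx⟩

theorem add_mem_Bset {x y : Ordinal} (hx : x ∈ Bset θ Ω Ωω n α) (hy : y ∈ Bset θ Ω Ωω n α) :
    x + y ∈ Bset θ Ω Ωω n α := by
  obtain ⟨i, hi⟩ := mem_iUnion.1 hx
  obtain ⟨j, hj⟩ := mem_iUnion.1 hy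
  exact mem_iUnion.2 ⟨max i j + 1, .inl (.inl (.inr ⟨x, Biter_mono _ (le_max_left i j) hi,
    y, Biter_mono _ (le_max_right i j) hj, rfl⟩))⟩

theorem phi_mem_Bset {x y : Ordinal} (hx : x ∈ Bset θ Ω Ωω n α) (hy : y ∈ Bset θ Ω Ωω n α) :
    phi x y ∈ Bset θ Ω Ωω n α := by
  obtain ⟨i, hi⟩ := mem_iUnion.1 hx
  obtain ⟨j, hj⟩ := mem_iUnion.1 hy
  exact mem_iUnion.2 ⟨max i j + 1, .inl (.inr ⟨x, Biter_mono _ (le_max_left i j) hi,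
    y, Biter_mono _ (le_max_right i j) hj, rfl⟩)⟩

theorem psi_mem_Bset {x : Ordinal} (m : ℕ) (hx : x ∈ Bset θ Ω Ωω n α) (hα : x < α) :
    psi θ Ω Ωω m x ∈ Bset θ Ω Ωω n α := by
  obtain ⟨i, hi⟩ := mem_iUnion.1 hx
  exact mem_iUnion.2 ⟨i + 1, .inr ⟨m, x, hi, hα, by simp only [dif_pos hα]⟩⟩

/-- `Bset` is the least set containing `Bbase` and closed under its generating operations. -/
theorem Bset_subset {Y : Set Ordinal} (hbase : Bbase θ Ω Ωω n ⊆ Y)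
    (hadd : ∀ x ∈ Y, ∀ y ∈ Y, x + y ∈ Y) (hphi : ∀ x ∈ Y, ∀ y ∈ Y, phi x y ∈ Y)
    (hpsi : ∀ m, ∀ x ∈ Bset θ Ω Ωω n α, x ∈ Y → x < α → psi θ Ω Ωω m x ∈ Y) :
    Bset θ Ω Ωω n α ⊆ Y := by
  refine iUnion_subset fun k => ?_
  induction k with
  | zero => exact hbase
  | succ k ih =>
    rintro z (((hz | ⟨x, hx, y, hy, rfl⟩) | ⟨x, hx, y, hy, rfl⟩) | ⟨m, x, hx, hlt, rfl⟩)
    · exact ih hz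
    · exact hadd _ (ih hx) _ (ih hy)
    · exact hphi _ (ih hx) _ (ih hy)
    · simp only [dif_pos hlt]
      exact hpsi m x (mem_iUnion.2 ⟨k, hx⟩) (ih hx) hlt

theorem Bset_mono (h : α ≤ β) : Bset θ Ω Ωω n α ⊆ Bset θ Ω Ωω n β :=
  Bset_subset Bbase_subset_Bset (fun _ hx _ hy => add_mem_Bset hx hy)
    (fun _ hx _ hy => phi_mem_Bset hx hy) fun m _ _ hx hlt => psi_mem_Bset m hx (hlt.trans_le h)

theorem Bset_add_one_of_notMem (h : α ∉ Bset θ Ω Ωω n α) :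
    Bset θ Ω Ωω n (α + 1) = Bset θ Ω Ωω n α := by
  refine (Bset_subset Bbase_subset_Bset (fun _ hx _ hy => add_mem_Bset hx hy)
    (fun _ hx _ hy => phi_mem_Bset hx hy) fun m x _ hx hlt => psi_mem_Bset m hx ?_).antisymm
    (Bset_mono (Order.lt_add_one_iff.2 le_rfl).le)
  refine (Order.lt_add_one_iff.1 hlt).lt_of_ne ?_
  rintro rfl
  exact h hx

theorem psi_eq_sInf : psi θ Ω Ωω n α = sInf {β | β ∉ Bset θ Ω Ωω n α} := by
  rw [psi]; rfl

theorem mem_Bset_of_lt_psi {x : Ordinal} (h : x < psi θ Ω Ωω n α) : x ∈ Bset θ Ω Ωω n α := by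
  rw [psi_eq_sInf] at h
  simpa using notMem_of_lt_csInf' h

end Closure

section Cardinality

open Cardinal

theorem mk_Bstep_lt {c : Cardinal.{u + 1}} (hc : ℵ₀ < c) (f : ℕ → Ordinal.{u} → Ordinal.{u})
    (α : Ordinal.{u}) {S : Set Ordinal.{u}} (hS : #S < c) : #(Bstep f α S) < c := by
  have hSS : #(S × S) < c := by
    simp only [mk_prod, Cardinal.lift_id]
    exact mul_lt_of_lt hc.le hS hS
  have hNS : #(ULift.{u + 1} ℕ × S) < c := by
    simp only [mk_prod, Cardinal.lift_id]
    exact mul_lt_of_lt hc.le (by simpa using hc) hS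
  refine (mk_union_le _ _).trans_lt (add_lt_of_lt hc.le ((mk_union_le _ _).trans_lt
    (add_lt_of_lt hc.le ((mk_union_le _ _).trans_lt (add_lt_of_lt hc.le hS ?_)) ?_)) ?_)
  · refine (mk_le_mk_of_subset ?_).trans_lt
      ((mk_range_le (f := fun p : S × S => (p.1 : Ordinal) + p.2)).trans_lt hSS)
    rintro _ ⟨x, hx, y, hy, rfl⟩
    exact ⟨(⟨x, hx⟩, ⟨y, hy⟩), rfl⟩
  · refine (mk_le_mk_of_subset ?_).trans_lt
      ((mk_range_le (f := fun p : S × S => phi p.1 p.2)).trans_lt hSS)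
    rintro _ ⟨x, hx, y, hy, rfl⟩
    exact ⟨(⟨x, hx⟩, ⟨y, hy⟩), rfl⟩
  · refine (mk_le_mk_of_subset ?_).trans_lt
      ((mk_range_le (f := fun p : ULift.{u + 1} ℕ × S => f p.1.down p.2)).trans_lt hNS)
    rintro _ ⟨m, x, hx, -, rfl⟩
    exact ⟨(⟨m⟩, ⟨x, hx⟩), rfl⟩

theorem mk_Bset_lt {θ : Ordinal.{u}} {Ω : ℕ → Ordinal.{u}} {Ωω : Ordinal.{u}} {n : ℕ}
    {c : Cardinal.{u + 1}}
    (hc : ℵ₀ < c) (hreg : c.IsRegular) (hbase : #(Bbase θ Ω Ωω n) < c) (α : Ordinal.{u}) :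
    #(Bset θ Ω Ωω n α) < c := by
  rw [Bset, ← Equiv.ulift.surjective.iUnion_comp,
    card_iUnion_lt_iff_forall_of_isRegular hreg (by simpa using hc)]
  rintro ⟨k⟩
  induction k with
  | zero => exact hbase
  | succ k ih => exact mk_Bstep_lt hc _ _ ih

theorem mk_Bbase_lt {θ : Ordinal.{u}} {Ω : ℕ → Ordinal.{u}} {Ωω : Ordinal.{u}} {n : ℕ}
    {κ : Cardinal.{u}}
    (hκ : ℵ₀ < κ) (hθ : θ < κ.ord) (hΩ : ∀ k < n, Ω k < κ.ord) :
    #(Bbase θ Ω Ωω n) < Cardinal.lift.{u + 1} κ := by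
  have hc : ℵ₀ < Cardinal.lift.{u + 1} κ := by simpa using hκ
  have hIio : ∀ o < κ.ord, #(Iio o) < Cardinal.lift.{u + 1} κ := fun o ho => by
    rw [Cardinal.mk_Iio_ordinal]
    exact Cardinal.lift_lt.2 (lt_ord.1 ho)
  have hcount : #{x | (∃ m : ℕ, x = Ω m) ∨ x = Ωω} < Cardinal.lift.{u + 1} κ := by
    refine lt_of_le_of_lt (le_aleph0_iff_set_countable.2 ?_) hc
    refine ((countable_range Ω).union (countable_singleton Ωω)).mono ?_
    rintro x (⟨m, rfl⟩ | rfl)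
    · exact .inl ⟨m, rfl⟩
    · exact .inr rfl
  cases n with
  | succ n =>
    exact (mk_union_le _ _).trans_lt (add_lt_of_lt hc.le (hIio _ (hΩ n n.lt_succ_self)) hcount)
  | zero =>
    refine (mk_union_le _ _).trans_lt (add_lt_of_lt hc.le ((mk_union_le _ _).trans_lt
      (add_lt_of_lt hc.le ?_ ?_)) hcount)
    · rw [mk_singleton]
      exact one_lt_aleph0.trans hc
    · refine (mk_le_mk_of_subset (t := Gamma '' Iio (θ + 1)) ?_).trans_lt
        (mk_image_le.trans_lt (hIio _ ((isSuccLimit_ord hκ.le).add_one_lt hθ)))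
      rintro _ ⟨b, hb, rfl⟩
      exact ⟨b, Order.lt_add_one_iff.2 hb, rfl⟩

end Cardinality

section Collapse

variable {θ : Ordinal.{u}} {Ω : ℕ → Ordinal.{u}} {Ωω : Ordinal.{u}} {n : ℕ} {α β : Ordinal.{u}}

theorem zero_mem_Bset (hΩreg : ∀ n : ℕ, IsUncountableRegular (Ω n)) :
    0 ∈ Bset θ Ω Ωω n α := by
  refine Bbase_subset_Bset ?_
  cases n with
  | zero => exact .inl (.inl rfl)
  | succ n =>
    obtain ⟨κ, -, hκ, h⟩ := hΩreg n
    exact .inl (h ▸ hκ.ord_pos)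

theorem exists_lt_notMem_Bset (hΩreg : ∀ n : ℕ, IsUncountableRegular (Ω n))
    (hΩmono : StrictMono Ω) (hθ : θ < Ω 0) : ∃ x < Ω n, x ∉ Bset θ Ω Ωω n α := by
  obtain ⟨κ, hκ, hreg, h⟩ := hΩreg n
  by_contra! hsub
  have hlt := mk_Bset_lt (Ωω := Ωω) (c := Cardinal.lift.{u + 1} κ) (by simpa using hκ) hreg.lift
    (mk_Bbase_lt (Ω := Ω) (n := n) hκ (h ▸ hθ.trans_le (hΩmono.monotone n.zero_le))
      fun k hk => h ▸ hΩmono hk) α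
  have hle := Cardinal.mk_le_mk_of_subset (s := Iio (Ω n)) hsub
  rw [Cardinal.mk_Iio_ordinal, h, Cardinal.card_ord] at hle
  exact hle.not_gt hlt

theorem psi_notMem_Bset (hΩreg : ∀ n : ℕ, IsUncountableRegular (Ω n))
    (hΩmono : StrictMono Ω) (hθ : θ < Ω 0) : psi θ Ω Ωω n α ∉ Bset θ Ω Ωω n α := by
  obtain ⟨x, -, hx⟩ := exists_lt_notMem_Bset (n := n) (α := α) (Ωω := Ωω) hΩreg hΩmono hθ
  rw [psi_eq_sInf]
  exact csInf_mem (s := {β | β ∉ Bset θ Ω Ωω n α}) ⟨x, hx⟩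

theorem psi_lt (hΩreg : ∀ n : ℕ, IsUncountableRegular (Ω n))
    (hΩmono : StrictMono Ω) (hθ : θ < Ω 0) : psi θ Ω Ωω n α < Ω n := by
  obtain ⟨x, hlt, hx⟩ := exists_lt_notMem_Bset (n := n) (α := α) (Ωω := Ωω) hΩreg hΩmono hθ
  rw [psi_eq_sInf]
  exact (csInf_le' hx).trans_lt hlt

theorem psi_mono (hΩreg : ∀ n : ℕ, IsUncountableRegular (Ω n))
    (hΩmono : StrictMono Ω) (hθ : θ < Ω 0) (h : α ≤ β) :
    psi θ Ω Ωω n α ≤ psi θ Ω Ωω n β :=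
  le_of_not_gt fun hlt =>
    psi_notMem_Bset hΩreg hΩmono hθ (Bset_mono h (mem_Bset_of_lt_psi hlt))

theorem stronglyCritical_psi (hΩreg : ∀ n : ℕ, IsUncountableRegular (Ω n))
    (hΩmono : StrictMono Ω) (hθ : θ < Ω 0) : StronglyCritical (psi θ Ω Ωω n α) := by
  have hmem := psi_notMem_Bset (n := n) (α := α) (Ωω := Ωω) hΩreg hΩmono hθ
  by_contra hsc
  obtain ⟨a, ha, b, hb, h | h⟩ := exists_lt_of_not_stronglyCritical
    (fun h0 => hmem (by rw [h0]; exact zero_mem_Bset hΩreg)) hsc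
  · exact hmem (h ▸ add_mem_Bset (mem_Bset_of_lt_psi ha) (mem_Bset_of_lt_psi hb))
  · exact hmem (h ▸ phi_mem_Bset (mem_Bset_of_lt_psi ha) (mem_Bset_of_lt_psi hb))

theorem lt_psi_add_one (hΩreg : ∀ n : ℕ, IsUncountableRegular (Ω n))
    (hΩmono : StrictMono Ω) (hθ : θ < Ω 0) (m : ℕ) :
    Ω m < psi θ Ω Ωω (m + 1) α := by
  refine lt_of_not_ge fun hle => psi_notMem_Bset (n := m + 1) (α := α) (Ωω := Ωω) hΩreg hΩmono hθ
    (Bbase_subset_Bset ?_)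
  rcases hle.lt_or_eq with h | h
  · exact .inl h
  · exact .inr (.inl ⟨m, h⟩)

theorem lt_psi_of_lt (hΩreg : ∀ n : ℕ, IsUncountableRegular (Ω n))
    (hΩmono : StrictMono Ω) (hθ : θ < Ω 0) {m : ℕ} (h : m < n) :
    Ω m < psi θ Ω Ωω n α := by
  cases n with
  | zero => exact absurd h m.not_lt_zero
  | succ n =>
    exact (hΩmono.monotone (Nat.lt_succ_iff.1 h)).trans_lt (lt_psi_add_one hΩreg hΩmono hθ n)

theorem Gamma_lt_psi (hΩreg : ∀ n : ℕ, IsUncountableRegular (Ω n))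
    (hΩmono : StrictMono Ω) (hθ : θ < Ω 0) (hβ : β ≤ θ) :
    Gamma β < psi θ Ω Ωω 0 α := by
  induction β using WellFoundedLT.induction with
  | ind β ih =>
    refine (enumOrd_le_of_forall_lt (stronglyCritical_psi hΩreg hΩmono hθ)
      fun b hb => ih b hb (hb.le.trans hβ)).lt_of_ne fun h => ?_
    refine psi_notMem_Bset (n := 0) (α := α) (Ωω := Ωω) hΩreg hΩmono hθ
      (Bbase_subset_Bset (.inl (.inr ⟨β, hβ, ?_⟩)))
    exact h.symm

/-- Below `Ω n`, the set `Bset n α` is bounded by any strongly critical ordinal that lies above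
the base set and above all `psi n δ` with `δ ∈ Bset n α` and `δ < α`. -/
theorem lt_of_mem_Bset (hΩreg : ∀ n : ℕ, IsUncountableRegular (Ω n))
    (hΩmono : StrictMono Ω) (hΩltω : ∀ n : ℕ, Ω n < Ωω) (hθ : θ < Ω 0) {γ : Ordinal}
    (hγ : StronglyCritical γ) (hle : psi θ Ω Ωω n β ≤ γ)
    (hpsi : ∀ δ ∈ Bset θ Ω Ωω n α, δ < α → psi θ Ω Ωω n δ < γ)
    {x : Ordinal} (hx : x ∈ Bset θ Ω Ωω n α) (hxn : x < Ω n) : x < γ := by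
  refine Bset_subset (Y := {x | x < Ω n → x < γ}) ?_ ?_ ?_ ?_ hx hxn
  · have hΩ : ∀ x, ((∃ m : ℕ, x = Ω m) ∨ x = Ωω) → x < Ω n → x < γ := by
      rintro x (⟨m, rfl⟩ | rfl) h
      · exact (lt_psi_of_lt hΩreg hΩmono hθ (hΩmono.lt_iff_lt.1 h)).trans_le hle
      · exact absurd h (hΩltω n).not_gt
    cases n with
    | zero =>
      rintro x ((rfl | ⟨b, hb, rfl⟩) | h) hlt
      · exact pos_iff_ne_zero.2 hγ.1
      · exact (Gamma_lt_psi hΩreg hΩmono hθ hb).trans_le hle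
      · exact hΩ x h hlt
    | succ n =>
      rintro x (h | h) hlt
      · exact (lt_trans h (lt_psi_add_one hΩreg hΩmono hθ n)).trans_le hle
      · exact hΩ x h hlt
  · exact fun x hx y hy h => hγ.add_lt (hx (le_self_add.trans_lt h)) (hy (le_add_self.trans_lt h))
  · exact fun x hx y hy h =>
      hγ.2 x (hx ((left_le_phi x y).trans_lt h)) y (hy ((right_le_phi x y).trans_lt h))
  · intro m δ hδ _ hlt h
    rcases lt_trichotomy m n with hm | rfl | hm
    · exact ((psi_lt hΩreg hΩmono hθ).trans (lt_psi_of_lt hΩreg hΩmono hθ hm)).trans_le hle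
    · exact hpsi δ hδ hlt
    · exact absurd h (lt_psi_of_lt hΩreg hΩmono hθ hm).not_gt

end Collapse

/-- If `α ∈ B_n(α)` then `ψ_n(α+1) = (ψ_n(α))^Γ`, the least strongly critical ordinal
strictly greater than `ψ_n(α)`; if `α ∉ B_n(α)` then `ψ_n(α+1) = ψ_n(α)`.  In particular
`ψ_n(α+1) ∈ {ψ_n(α), (ψ_n(α))^Γ}`. -/
theorem psi_succ (θ : Ordinal) (Ω : ℕ → Ordinal) (Ωω : Ordinal)
    (hΩreg : ∀ n : ℕ, IsUncountableRegular (Ω n)) (hΩωreg : IsUncountableRegular Ωω)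
    (hΩmono : ∀ n : ℕ, Ω n < Ω (n + 1)) (hΩltω : ∀ n : ℕ, Ω n < Ωω)
    (hθ : θ < Ω 0)
    (n : ℕ) (α : Ordinal) :
    (α ∈ Bset θ Ω Ωω n α → psi θ Ω Ωω n (α + 1) = nextGamma (psi θ Ω Ωω n α)) ∧
      (α ∉ Bset θ Ω Ωω n α → psi θ Ω Ωω n (α + 1) = psi θ Ω Ωω n α) ∧
      (psi θ Ω Ωω n (α + 1) = psi θ Ω Ωω n α ∨
        psi θ Ω Ωω n (α + 1) = nextGamma (psi θ Ω Ωω n α)) := by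
  have hmono : StrictMono Ω := strictMono_nat_of_lt_succ hΩmono
  have hmem : α ∈ Bset θ Ω Ωω n α → psi θ Ω Ωω n (α + 1) = nextGamma (psi θ Ω Ωω n α) := by
    intro h
    have hα : α < α + 1 := Order.lt_add_one_iff.2 le_rfl
    have hlt : psi θ Ω Ωω n α < psi θ Ω Ωω n (α + 1) := by
      refine (psi_mono hΩreg hmono hθ hα.le).lt_of_ne fun heq => ?_
      exact psi_notMem_Bset (n := n) (α := α + 1) (Ωω := Ωω) hΩreg hmono hθ
        (heq ▸ psi_mem_Bset n (Bset_mono hα.le h) hα)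
    have hsc : psi θ Ω Ωω n (α + 1) ∈ {x | StronglyCritical x ∧ psi θ Ω Ωω n α < x} :=
      ⟨stronglyCritical_psi hΩreg hmono hθ, hlt⟩
    obtain ⟨hγ, hltγ⟩ := csInf_mem ⟨_, hsc⟩
    refine le_antisymm (le_of_not_gt fun hgt => ?_) (csInf_le' hsc)
    refine lt_irrefl _ (lt_of_mem_Bset hΩreg hmono hΩltω hθ hγ hltγ.le (fun δ _ hδ => ?_)
      (mem_Bset_of_lt_psi hgt) (hgt.trans (psi_lt hΩreg hmono hθ)))
    exact (psi_mono hΩreg hmono hθ (Order.lt_add_one_iff.1 hδ)).trans_lt hltγ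
  have hnot : α ∉ Bset θ Ω Ωω n α → psi θ Ω Ωω n (α + 1) = psi θ Ω Ωω n α := fun h => by
    rw [psi_eq_sInf, psi_eq_sInf, Bset_add_one_of_notMem h]
  refine ⟨hmem, hnot, ?_⟩
  by_cases h : α ∈ Bset θ Ω Ωω n α
  · exact .inr (hmem h)
  · exact .inl (hnot h)
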